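/- arXiv:2207.08703 — 15 statements merged into one kernel-verified Lean document; each statement's English description precedes it below -/
import Mathlib

section
/- Let K be a field of characteristic zero, λ ∈ K, and let (g, P) be a Rota-Baxter Lie algebra of weight λ over K. Let V be a K-vector space, ρ : g → End(V) a representation of the Lie algebra g (i.e. ρ⁅x,y⁆ = ρ(x)∘ρ(y) − ρ(y)∘ρ(x)), and α : V → V a linear map. Equip the direct sum g ⊕ V with the semi-direct product Lie bracket ⁅(x,u),(y,v)⁆ = (⁅x,y⁆, ρ(x)v − ρ(y)u) and define the linear map P⊕α : g ⊕ V → g ⊕ V by (P⊕α)(x,u) = (P x, α u). Then (ρ, α; V) is a representation of the Rota-Baxter Lie algebra (g, P), i.e. ρ(P x)(α v) = α(ρ(P x)v) + α(ρ(x)(α v)) + λ • α(ρ(x)v) for all x ∈ g, v ∈ V, if and only if P⊕α is a Rota-Baxter operator of weight λ on the semi-direct product Lie algebra g ⋉_ρ V. -/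
/-- The semi-direct product Lie bracket on `g × V` induced by a representation `ρ`. -/
def sdBracket {K g V : Type*} [Field K] [LieRing g] [LieAlgebra K g]
    [AddCommGroup V] [Module K V] (ρ : g →ₗ[K] Module.End K V) :
    g × V → g × V → g × V :=
  fun p q => (⁅p.1, q.1⁆, ρ p.1 q.2 - ρ q.1 p.2)

/-- `(ρ, α; V)` is a representation of the Rota-Baxter Lie algebra `(g, P)`
of weight `λ` iff `P ⊕ α` is a Rota-Baxter operator of weight `λ` on the semi-direct
product Lie algebra `g ⋉_ρ V`. -/
theorem stmt0 (K : Type*) [Field K] [CharZero K] (lam : K)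
    (g : Type*) [LieRing g] [LieAlgebra K g]
    (V : Type*) [AddCommGroup V] [Module K V]
    (P : g →ₗ[K] g)
    (hP : ∀ x y : g, ⁅P x, P y⁆ = P ⁅P x, y⁆ + P ⁅x, P y⁆ + lam • P ⁅x, y⁆)
    (ρ : g →ₗ[K] Module.End K V)
    (hρ : ∀ x y : g, ρ ⁅x, y⁆ = ρ x * ρ y - ρ y * ρ x)
    (α : V →ₗ[K] V) :
    (∀ (x : g) (v : V),
        ρ (P x) (α v) = α (ρ (P x) v) + α (ρ x (α v)) + lam • α (ρ x v)) ↔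
      (∀ p q : g × V,
        sdBracket ρ (Prod.map (⇑P) (⇑α) p) (Prod.map (⇑P) (⇑α) q) =
          Prod.map (⇑P) (⇑α) (sdBracket ρ (Prod.map (⇑P) (⇑α) p) q) +
          Prod.map (⇑P) (⇑α) (sdBracket ρ p (Prod.map (⇑P) (⇑α) q)) +
          lam • Prod.map (⇑P) (⇑α) (sdBracket ρ p q)) := by
  constructor
  · rintro h ⟨x, u⟩ ⟨y, v⟩
    refine Prod.ext (hP x y) ?_
    simp only [sdBracket, Prod.map_apply, Prod.snd_add, Prod.smul_snd, map_sub, smul_sub, h]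
    abel
  · intro h x v
    simpa [sdBracket] using congrArg Prod.snd (h (x, 0) (0, v))
end

section
/- Let K be a field of characteristic zero, λ ∈ K, (g, P) a Rota-Baxter Lie algebra of weight λ over K, V a finite-dimensional K-vector space, ρ : g → End(V) a representation of the Lie algebra g, and β : V → V a linear map. Define ρ* : g → End(V*) by (ρ*(x)f)(u) = −f(ρ(x)u) and let β* : V* → V* be the transpose of β, i.e. (β* f)(u) = f(β u). Then (ρ*, β*; V*) is a representation of the Rota-Baxter Lie algebra (g, P), i.e. ρ*(P x)(β* f) = β*(ρ*(P x)f) + β*(ρ*(x)(β* f)) + λ • β*(ρ*(x)f) for all x ∈ g, f ∈ V*, if and only if β(ρ(P x)v) − ρ(P x)(β v) − β(ρ(x)(β v)) − λ • ρ(x)(β v) = 0 for all x ∈ g, v ∈ V. -/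
/-- For a Rota-Baxter Lie algebra `(g, P)` of weight `λ`, a representation
`ρ` on a finite-dimensional space `V` and a linear map `β : V → V`, the triple
`(ρ*, β*; V*)`, with `ρ*(x) = -(ρ x)ᵀ` and `β*` the transpose of `β`, is a representation
of `(g, P)` iff `β (ρ (P x) v) - ρ (P x) (β v) - β (ρ x (β v)) - λ • ρ x (β v) = 0`
for all `x, v`. -/
theorem stmt1 (K : Type*) [Field K] [CharZero K] (lam : K)
    (g : Type*) [LieRing g] [LieAlgebra K g]
    (V : Type*) [AddCommGroup V] [Module K V] [FiniteDimensional K V]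
    (P : g →ₗ[K] g)
    (hP : ∀ x y : g, ⁅P x, P y⁆ = P ⁅P x, y⁆ + P ⁅x, P y⁆ + lam • P ⁅x, y⁆)
    (ρ : g →ₗ[K] Module.End K V)
    (hρ : ∀ x y : g, ρ ⁅x, y⁆ = ρ x * ρ y - ρ y * ρ x)
    (β : V →ₗ[K] V) :
    (∀ (x : g) (f : Module.Dual K V),
        (-(ρ (P x)).dualMap) (β.dualMap f) =
          β.dualMap ((-(ρ (P x)).dualMap) f) +
          β.dualMap ((-(ρ x).dualMap) (β.dualMap f)) +
          lam • β.dualMap ((-(ρ x).dualMap) f)) ↔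
      (∀ (x : g) (v : V),
        β (ρ (P x) v) - ρ (P x) (β v) - β (ρ x (β v)) - lam • ρ x (β v) = 0) := by
  have key (x : g) (f : Module.Dual K V) (v : V) :
      f (β (ρ (P x) v) - ρ (P x) (β v) - β (ρ x (β v)) - lam • ρ x (β v)) =
        (β.dualMap ((-(ρ (P x)).dualMap) f) + β.dualMap ((-(ρ x).dualMap) (β.dualMap f)) +
          lam • β.dualMap ((-(ρ x).dualMap) f)) v - (-(ρ (P x)).dualMap) (β.dualMap f) v := by
    simp only [map_sub, map_smul, smul_eq_mul, LinearMap.add_apply, LinearMap.smul_apply,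
      LinearMap.neg_apply, LinearMap.dualMap_apply]
    ring
  constructor
  · intro h x v
    rw [← Module.forall_dual_apply_eq_zero_iff K]
    intro f
    rw [key, h x f, sub_self]
  · intro h x f
    ext v
    have hv := key x f v
    rw [h x v, map_zero] at hv
    exact (sub_eq_zero.mp hv.symm).symm
end

section
/- Let K be a field of characteristic zero, λ ∈ K, (g, P) a Rota-Baxter Lie algebra of weight λ over K, and (ρ, α; V) a representation of (g, P). Then the linear map β := −α − λ • id_V is admissible to (g, P) on (ρ, V), i.e. β(ρ(P x)v) − ρ(P x)(β v) − β(ρ(x)(β v)) − λ • ρ(x)(β v) = 0 for all x ∈ g, v ∈ V. -/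
/-- For a representation `(ρ, α; V)` of a Rota-Baxter Lie algebra `(g, P)`
of weight `λ`, the map `β = -α - λ•id` is admissible to `(g, P)` on `(ρ, V)`. -/
theorem stmt2 (K : Type*) [Field K] [CharZero K] (lam : K)
    (g : Type*) [LieRing g] [LieAlgebra K g]
    (V : Type*) [AddCommGroup V] [Module K V]
    (P : g →ₗ[K] g)
    (hP : ∀ x y : g, ⁅P x, P y⁆ = P ⁅P x, y⁆ + P ⁅x, P y⁆ + lam • P ⁅x, y⁆)
    (ρ : g →ₗ[K] Module.End K V)
    (hρ : ∀ x y : g, ρ ⁅x, y⁆ = ρ x * ρ y - ρ y * ρ x)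
    (α : V →ₗ[K] V)
    (hα : ∀ (x : g) (v : V),
        ρ (P x) (α v) = α (ρ (P x) v) + α (ρ x (α v)) + lam • α (ρ x v)) :
    ∀ (x : g) (v : V),
      (-α - lam • LinearMap.id : V →ₗ[K] V) (ρ (P x) v) -
        ρ (P x) ((-α - lam • LinearMap.id : V →ₗ[K] V) v) -
        (-α - lam • LinearMap.id : V →ₗ[K] V)
          (ρ x ((-α - lam • LinearMap.id : V →ₗ[K] V) v)) -
        lam • ρ x ((-α - lam • LinearMap.id : V →ₗ[K] V) v) = 0 := by
  intro x v
  simp only [LinearMap.sub_apply, LinearMap.neg_apply, LinearMap.smul_apply, LinearMap.id_apply,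
    map_sub, map_neg, map_smul, hα x v]
  module
end

section
/- Let K be a field of characteristic zero, λ ∈ K, and (g, P) a Rota-Baxter Lie algebra of weight λ over K. Let B : g × g → K be a nondegenerate invariant bilinear form (B(⁅x,y⁆,z) = B(x,⁅y,z⁆) for all x,y,z), and let P̂ : g → g be a linear map satisfying B(P x, y) = B(x, P̂ y) for all x, y ∈ g (the adjoint of P with respect to B). Then P̂ is admissible to (g, P), i.e. P̂⁅P x, y⁆ − ⁅P x, P̂ y⁆ − P̂⁅x, P̂ y⁆ − λ • ⁅x, P̂ y⁆ = 0 for all x, y ∈ g. -/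
/-- Let `(g, P)` be a Rota-Baxter Lie algebra of weight `λ`, `B` a
nondegenerate invariant bilinear form on `g`, and `P̂` the adjoint of `P` with respect
to `B`. Then `P̂` is admissible to `(g, P)`. -/
theorem stmt4 (K : Type*) [Field K] [CharZero K] (lam : K)
    (g : Type*) [LieRing g] [LieAlgebra K g]
    (P : g →ₗ[K] g)
    (hP : ∀ x y : g, ⁅P x, P y⁆ = P ⁅P x, y⁆ + P ⁅x, P y⁆ + lam • P ⁅x, y⁆)
    (B : g →ₗ[K] g →ₗ[K] K)
    (hInv : ∀ x y z : g, B ⁅x, y⁆ z = B x ⁅y, z⁆)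
    (hNondegL : ∀ x : g, (∀ y : g, B x y = 0) → x = 0)
    (hNondegR : ∀ y : g, (∀ x : g, B x y = 0) → y = 0)
    (Phat : g →ₗ[K] g)
    (hPhat : ∀ x y : g, B (P x) y = B x (Phat y)) :
    ∀ x y : g,
      Phat ⁅P x, y⁆ - ⁅P x, Phat y⁆ - Phat ⁅x, Phat y⁆ - lam • ⁅x, Phat y⁆ = 0 := by
  intro x y
  refine hNondegR _ fun z => ?_
  simp only [map_sub, map_smul, ← hPhat, ← hInv, hP z x, map_add, LinearMap.add_apply,
    LinearMap.smul_apply]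
  abel
end

section
/- Let K be a field of characteristic zero, (g, P) a Rota-Baxter Lie algebra of weight zero over K, and (ρ, α; V) a representation of (g, P). Define linear maps l, r : g → End(V) by l(x)v = ρ(P x)v and r(x)v = −ρ(x)(α v), and let x ∘ y = ⁅P x, y⁆ be the induced pre-Lie product on g. Then (l, r; V) is a representation of the pre-Lie algebra (g, ∘): for all x, y ∈ g and v ∈ V, l(x)(l(y)v) − l(x ∘ y)v = l(y)(l(x)v) − l(y ∘ x)v, and l(x)(r(y)v) − r(y)(l(x)v) = r(x ∘ y)v − r(y)(r(x)v). -/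
/-- A representation `(ρ, α; V)` of a Rota-Baxter Lie algebra `(g, P)` of
weight zero induces a representation `(l, r; V)` of the induced pre-Lie algebra
`x ∘ y = ⁅P x, y⁆`, where `l x v = ρ (P x) v` and `r x v = -ρ x (α v)`. -/
theorem stmt6 (K : Type*) [Field K] [CharZero K]
    (g : Type*) [LieRing g] [LieAlgebra K g]
    (V : Type*) [AddCommGroup V] [Module K V]
    (P : g →ₗ[K] g)
    (hP : ∀ x y : g, ⁅P x, P y⁆ = P ⁅P x, y⁆ + P ⁅x, P y⁆)
    (ρ : g →ₗ[K] Module.End K V)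
    (hρ : ∀ x y : g, ρ ⁅x, y⁆ = ρ x * ρ y - ρ y * ρ x)
    (α : V →ₗ[K] V)
    (hα : ∀ (x : g) (v : V),
        ρ (P x) (α v) = α (ρ (P x) v) + α (ρ x (α v))) :
    (∀ (x y : g) (v : V),
        ρ (P x) (ρ (P y) v) - ρ (P ⁅P x, y⁆) v =
          ρ (P y) (ρ (P x) v) - ρ (P ⁅P y, x⁆) v) ∧
    (∀ (x y : g) (v : V),
        ρ (P x) (-(ρ y (α v))) - (-(ρ y (α (ρ (P x) v)))) =
          -(ρ ⁅P x, y⁆ (α v)) - (-(ρ y (α (-(ρ x (α v))))))) := by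
  refine ⟨fun x y v => ?_, fun x y v => ?_⟩
  · have h := congrArg (fun z => ρ z v) (hP x y)
    rw [← lie_skew x (P y)] at h
    simp only [hρ, map_neg, map_add, LinearMap.sub_apply, LinearMap.add_apply,
      LinearMap.neg_apply, Module.End.mul_apply] at h ⊢
    rw [sub_eq_sub_iff_add_eq_add]
    rw [sub_eq_iff_eq_add] at h
    rw [h]
    abel
  · have h := congrArg (ρ y) (hα x v)
    simp only [hρ, map_neg, map_add, LinearMap.sub_apply, Module.End.mul_apply] at h ⊢
    rw [h]
    abel
end

section
/- Let K be a field of characteristic zero and (A, ∘) a pre-Lie algebra over K. Let ◁ : A × A → A be an antisymmetric bilinear map (x ◁ y = −(y ◁ x)) and define x ▷ y := x ∘ y − x ◁ y. Then the following are equivalent: (a) (A, ▷, ◁) is an L-dendriform algebra, i.e. for all x,y,z ∈ A, (x▷y)▷z + (x◁y)▷z + y▷(x▷z) − (y◁x)▷z − (y▷x)▷z − x▷(y▷z) = 0 and (x▷y)◁z + y◁(x▷z) + y◁(x◁z) − (y◁x)◁z − x▷(y◁z) = 0; (b) x◁(y◁z) + y◁(x∘z) − z◁(x∘y) − x∘(y◁z)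 = 0 for all x,y,z ∈ A; (c) the pair (L_∘ − L_◁, −L_◁; A) is a representation of the pre-Lie algebra (A, ∘), where L_∘(x)y = x ∘ y and L_◁(x)y = x ◁ y. -/
/-- Let `(A, ∘)` be a pre-Lie algebra, `◁` an antisymmetric bilinear map
and `x ▷ y = x ∘ y - x ◁ y`.  The following are equivalent:
(a) `(A, ▷, ◁)` is a (special) L-dendriform algebra;
(b) `x◁(y◁z) + y◁(x∘z) − z◁(x∘y) − x∘(y◁z) = 0`;
(c) `(L∘ − L◁, −L◁; A)` is a representation of `(A, ∘)`. -/
theorem stmt7 (K : Type*) [Field K] [CharZero K]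
    (A : Type*) [AddCommGroup A] [Module K A]
    (c : A →ₗ[K] A →ₗ[K] A)
    (hpre : ∀ x y z : A,
      c (c x y) z - c x (c y z) = c (c y x) z - c y (c x z))
    (d : A →ₗ[K] A →ₗ[K] A)
    (hanti : ∀ x y : A, d x y = -(d y x)) :
    -- (a) ↔ (b)
    (((∀ x y z : A,
        (fun u v => c u v - d u v) ((fun u v => c u v - d u v) x y) z +
        (fun u v => c u v - d u v) (d x y) z +
        (fun u v => c u v - d u v) y ((fun u v => c u v - d u v) x z) -
        (fun u v => c u v - d u v) (d y x) z -
        (fun u v => c u v - d u v) ((fun u v => c u v - d u v) y x) z -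
        (fun u v => c u v - d u v) x ((fun u v => c u v - d u v) y z) = 0) ∧
      (∀ x y z : A,
        d ((fun u v => c u v - d u v) x y) z +
        d y ((fun u v => c u v - d u v) x z) + d y (d x z) -
        d (d y x) z -
        (fun u v => c u v - d u v) x (d y z) = 0)) ↔
      (∀ x y z : A,
        d x (d y z) + d y (c x z) - d z (c x y) - c x (d y z) = 0)) ∧
    -- (b) ↔ (c)
    ((∀ x y z : A,
        d x (d y z) + d y (c x z) - d z (c x y) - c x (d y z) = 0) ↔
      ((∀ (x y : A) (v : A),
          (c x (c y v - d y v) - d x (c y v - d y v)) -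
            (c (c x y) v - d (c x y) v) =
          (c y (c x v - d x v) - d y (c x v - d x v)) -
            (c (c y x) v - d (c y x) v)) ∧
        (∀ (x y : A) (v : A),
          (c x (-(d y v)) - d x (-(d y v))) - (-(d y (c x v - d x v))) =
            (-(d (c x y) v)) - (-(d y (-(d x v))))))) := by
  have hanti₂ (x y z : A) : d (d y x) z = -(d (d x y) z) := by
    rw [hanti y x, map_neg, LinearMap.neg_apply]
  simp only [map_sub, map_neg, LinearMap.sub_apply]
  refine ⟨⟨fun ⟨_, h⟩ x y z => ?_, fun h => ⟨fun x y z => ?_, fun x y z => ?_⟩⟩,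
    fun h => ⟨fun x y z => ?_, fun x y z => ?_⟩, fun ⟨_, h⟩ x y z => ?_⟩
  · linear_combination (norm := module) h x y z - hanti (c x y) z + hanti₂ x y z
  · linear_combination (norm := module)
      hpre x y z - h x y z + h y x z - hanti (c x y) z + hanti (c y x) z
  · linear_combination (norm := module) h x y z + hanti (c x y) z - hanti₂ x y z
  · linear_combination (norm := module)
      h x y z - h y x z - hpre x y z + hanti (c x y) z - hanti (c y x) z
  · linear_combination (norm := module) h x y z + hanti (c x y) z
  · linear_combination (norm := module) h x y z - hanti (c x y) z
end

section
/- Let K be a field of characteristic zero, (g, P) a Rota-Baxter Lie algebra of weight zero over K, and Q : g → g a linear map admissible to (g, P), i.e. Q⁅P x, y⁆ − ⁅P x, Q y⁆ − Q⁅x, Q y⁆ = 0 for all x, y. Define x ∘ y = ⁅P x, y⁆, x ◁ y = −Q⁅x, y⁆, and x ▷ y = x ∘ y − x ◁ y. Then (g, ▷, ◁) is a special L-dendriform algebra: ◁ is antisymmetric and the two L-dendriform identities hold; moreover it is compatible with the induced pre-Lie algebra (g, ∘): x ▷ y + x ◁ y = x ∘ y = x ▷ y − y ◁ x for all x, y ∈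 g. -/
/-- Let `(g, P)` be a Rota-Baxter Lie algebra of weight zero and `Q`
admissible to `(g, P)`.  With `x ∘ y = ⁅P x, y⁆`, `x ◁ y = -Q⁅x,y⁆` and
`x ▷ y = x ∘ y - x ◁ y`, the triple `(g, ▷, ◁)` is a special L-dendriform algebra
compatible with the induced pre-Lie algebra `(g, ∘)`. -/
theorem stmt8 (K : Type*) [Field K] [CharZero K]
    (g : Type*) [LieRing g] [LieAlgebra K g]
    (P : g →ₗ[K] g)
    (hP : ∀ x y : g, ⁅P x, P y⁆ = P ⁅P x, y⁆ + P ⁅x, P y⁆)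
    (Q : g →ₗ[K] g)
    (hQ : ∀ x y : g, Q ⁅P x, y⁆ - ⁅P x, Q y⁆ - Q ⁅x, Q y⁆ = 0) :
    let c : g → g → g := fun x y => ⁅P x, y⁆
    let d : g → g → g := fun x y => -Q ⁅x, y⁆
    let t : g → g → g := fun x y => c x y - d x y
    (∀ x y : g, d x y = -(d y x)) ∧
    (∀ x y z : g,
      t (t x y) z + t (d x y) z + t y (t x z) - t (d y x) z - t (t y x) z -
        t x (t y z) = 0) ∧
    (∀ x y z : g,
      d (t x y) z + d y (t x z) + d y (d x z) - d (d y x) z - t x (d y z) = 0) ∧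
    (∀ x y : g, t x y + d x y = c x y ∧ c x y = t x y - d y x) := by
  intro c d t
  have admissible (x u : g) : ⁅P x, Q u⁆ + Q ⁅x, Q u⁆ = Q ⁅P x, u⁆ := by
    rw [add_comm, eq_comm, ← sub_eq_iff_eq_add, ← sub_eq_zero]
    exact hQ x u
  have c_eq (x y : g) : t x y + d x y = c x y := sub_add_cancel _ _
  have d_antisymm (x y : g) : d x y = -(d y x) := by
    simp only [d]
    rw [← lie_skew x y, map_neg]
  have t_add (x y z : g) : t (x + y) z = t x z + t y z := by
    simp only [t, c, d, map_add, add_lie]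
    abel
  have t_t (x y z : g) :
      t x (t y z) = ⁅P x, ⁅P y, z⁆⁆ + Q (⁅P x, ⁅y, z⁆⁆ + ⁅x, ⁅P y, z⁆⁆) := by
    simp only [t, c, d, sub_neg_eq_add, lie_add, map_add, ← admissible x ⁅y, z⁆]
    abel
  have t_c (x y z : g) :
      t (c x y) z - t (c y x) z = ⁅⁅P x, P y⁆, z⁆ + Q (⁅⁅P x, y⁆, z⁆ + ⁅⁅x, P y⁆, z⁆) := by
    simp only [t, c, d, sub_neg_eq_add, hP, ← lie_skew x (P y), map_neg, map_add, neg_lie,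
      add_lie]
    abel
  refine ⟨d_antisymm, fun x y z => ?_, fun x y z => ?_, fun x y => ⟨c_eq x y, ?_⟩⟩
  · have h : t (c x y) z - t (c y x) z + t y (t x z) - t x (t y z) = 0 := by
      rw [t_c, t_t, t_t]
      simp only [lie_lie, map_add, map_sub]
      abel
    rw [← h, ← c_eq x y, ← c_eq y x, t_add, t_add]
    abel
  · have h := admissible x ⁅y, z⁆
    have hd : t x (d y z) = -Q ⁅P x, ⁅y, z⁆⁆ := by
      rw [← h]
      simp only [t, c, d, lie_neg, map_neg]
      abel
    rw [hd, d_antisymm y x]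
    simp only [t, c, d, sub_neg_eq_add, lie_add, add_lie, lie_neg, neg_neg, map_add,
      map_neg, lie_lie (P x), map_sub]
    abel
  · rw [← c_eq x y, d_antisymm y x, sub_neg_eq_add]
end

section
/- Let K be a field of characteristic zero and (g, P) a Rota-Baxter Lie algebra of weight zero over K. Define x ◁ y = P⁅x, y⁆ and x ▷ y = ⁅P x, y⁆ − P⁅x, y⁆. Then (g, ▷, ◁) is a special L-dendriform algebra: ◁ is antisymmetric and the two L-dendriform identities hold; moreover x ▷ y + x ◁ y = ⁅P x, y⁆ for all x, y ∈ g, so (g, ▷, ◁) is compatible with the induced pre-Lie algebra (g, ∘) with x ∘ y = ⁅P x, y⁆. -/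
/-- Let `(g, P)` be a Rota-Baxter Lie algebra of weight zero.  With
`x ◁ y = P⁅x,y⁆` and `x ▷ y = ⁅P x, y⁆ - P⁅x,y⁆`, the triple `(g, ▷, ◁)` is a special
L-dendriform algebra and `x ▷ y + x ◁ y = ⁅P x, y⁆`, so it is compatible with the
induced pre-Lie algebra. -/
theorem stmt9 (K : Type*) [Field K] [CharZero K]
    (g : Type*) [LieRing g] [LieAlgebra K g]
    (P : g →ₗ[K] g)
    (hP : ∀ x y : g, ⁅P x, P y⁆ = P ⁅P x, y⁆ + P ⁅x, P y⁆) :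
    let d : g → g → g := fun x y => P ⁅x, y⁆
    let t : g → g → g := fun x y => ⁅P x, y⁆ - P ⁅x, y⁆
    (∀ x y : g, d x y = -(d y x)) ∧
    (∀ x y z : g,
      t (t x y) z + t (d x y) z + t y (t x z) - t (d y x) z - t (t y x) z -
        t x (t y z) = 0) ∧
    (∀ x y z : g,
      d (t x y) z + d y (t x z) + d y (d x z) - d (d y x) z - t x (d y z) = 0) ∧
    (∀ x y : g, t x y + d x y = ⁅P x, y⁆) := by
  intro d t
  have split (x y : g) : t x y + d x y = ⁅P x, y⁆ := sub_add_cancel _ _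
  refine ⟨fun x y => ?_, fun x y z => ?_, fun x y z => ?_, split⟩
  · simp only [d]
    rw [← lie_skew, map_neg]
  · have hPxy : ⁅P ⁅P x, y⁆, z⁆ = ⁅⁅P x, P y⁆, z⁆ - ⁅P ⁅x, P y⁆, z⁆ := by
      rw [hP, add_lie, add_sub_cancel_right]
    have hPyx : ⁅P ⁅P y, x⁆, z⁆ = -⁅P ⁅x, P y⁆, z⁆ := by
      rw [← lie_skew (P y) x, map_neg, neg_lie]
    have hyx : P ⁅⁅P y, x⁆, z⁆ = -P ⁅⁅x, P y⁆, z⁆ := by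
      rw [← lie_skew (P y) x, neg_lie, map_neg]
    simp only [d, t, lie_sub, sub_lie, map_sub, hPxy, hPyx, hyx, hP _ ⁅_, z⁆]
    simp only [lie_lie, map_sub]
    abel
  · have hyx : P ⁅P ⁅y, x⁆, z⁆ = -P ⁅P ⁅x, y⁆, z⁆ := by
      rw [← lie_skew y x, map_neg, neg_lie, map_neg]
    simp only [d, t, lie_sub, sub_lie, map_sub, hyx, hP x]
    simp only [lie_lie, map_sub]
    abel
end

section
/- Let K be a field of characteristic zero, g a finite-dimensional Lie algebra over K with bracket ⁅·,·⁆_g, and suppose the dual space g* carries a Lie bracket ⁅·,·⁆_{g*}. Suppose the direct sum D = g ⊕ g* carries a Lie bracket ⁅·,·⁆ whose restriction to g is ⁅·,·⁆_g and to g* is ⁅·,·⁆_{g*}, and such that the bilinear form B_d((x,a),(y,b)) = b(x) + a(y) on D is invariant for ⁅·,·⁆. Let P, Q : g → g be linear maps, let Q* : g* → g* be the transpose of Q and P* : g* → g* the transpose of P, and suppose the map P⊕Q* : (x,a) ↦ (P x, Q* a) is a Rota-Baxter operator of weight λ on D (so (D, g, g*) is a Manin triple of Rota-Baxter Lie algebras).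 Then: (i) B_d((P⊕Q*)u, v) = B_d(u, (Q⊕P*)v) for all u, v ∈ D, and Q⊕P* : (x,a) ↦ (Q x, P* a) is admissible to the Rota-Baxter Lie algebra (D, P⊕Q*); (ii) Q is admissible to (g, P), i.e. Q⁅P x, y⁆_g − ⁅P x, Q y⁆_g − Q⁅x, Q y⁆_g − λ•⁅x, Q y⁆_g = 0 for all x, y ∈ g; (iii) P* is admissible to (g*, Q*), i.e. P*⁅Q* a, b⁆_{g*} − ⁅Q* a, P* b⁆_{g*} − P*⁅a, P* b⁆_{g*} − λ•⁅a, P* b⁆_{g*} = 0 for all a, b ∈ g*. -/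
/-- If `S` is the adjoint of a Rota-Baxter operator `T` of weight `lam` with respect to a symmetric
invariant form with trivial left radical, then `S` is admissible to `T`. -/
theorem LinearMap.BilinForm.admissible_of_adjoint_of_rotaBaxter {K V : Type*} [CommRing K]
    [AddCommGroup V] [Module K V] (B : LinearMap.BilinForm K V)
    (hsymm : ∀ u v, B u v = B v u) (hsep : ∀ u, (∀ w, B u w = 0) → u = 0)
    (br : V →ₗ[K] V →ₗ[K] V) (hanti : ∀ u v, br u v = -br v u)
    (hinv : ∀ u v w, B (br u v) w = B u (br v w)) (lam : K) (T S : V → V)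
    (hadj : ∀ u v, B (T u) v = B u (S v))
    (hRB : ∀ u v, br (T u) (T v) = T (br (T u) v) + T (br u (T v)) + lam • T (br u v))
    (u v : V) :
    S (br (T u) v) - br (T u) (S v) - S (br u (S v)) - lam • br u (S v) = 0 := by
  have hadj' : ∀ x y, B (S x) y = B x (T y) := fun x y => by
    rw [hsymm, ← hadj, hsymm]
  have hskew : ∀ x y z, B (br x y) z = -B y (br x z) := fun x y z => by
    rw [hanti x y, map_neg, LinearMap.neg_apply, hinv]
  refine hsep _ fun w => ?_
  simp only [map_sub, map_smul, LinearMap.sub_apply, LinearMap.smul_apply, hadj', hskew, hRB,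
    map_add, smul_eq_mul]
  ring

/-- The natural pairing on `V × Dual K V`. -/
def prodDualPairing (K V : Type*) [CommRing K] [AddCommGroup V] [Module K V] :
    LinearMap.BilinForm K (V × Module.Dual K V) :=
  LinearMap.mk₂ K (fun u v => v.2 u.1 + u.2 v.1)
    (fun u u' v => by simp only [Prod.fst_add, Prod.snd_add, map_add, LinearMap.add_apply]; ring)
    (fun c u v => by simp [mul_add])
    (fun u v v' => by simp only [Prod.fst_add, Prod.snd_add, map_add, LinearMap.add_apply]; ring)
    (fun c u v => by simp [mul_add])

theorem prodDualPairing_apply {K V : Type*} [CommRing K] [AddCommGroup V] [Module K V]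
    (u v : V × Module.Dual K V) : prodDualPairing K V u v = v.2 u.1 + u.2 v.1 := rfl

theorem prodDualPairing_symm {K V : Type*} [CommRing K] [AddCommGroup V] [Module K V]
    (u v : V × Module.Dual K V) : prodDualPairing K V u v = prodDualPairing K V v u :=
  add_comm _ _

theorem eq_zero_of_prodDualPairing_eq_zero {K V : Type*} [Field K] [AddCommGroup V] [Module K V]
    (u : V × Module.Dual K V) (h : ∀ w, prodDualPairing K V u w = 0) : u = 0 := by
  refine Prod.ext ((Module.forall_dual_apply_eq_zero_iff K u.1).1 fun f => ?_)
    (LinearMap.ext fun x => ?_)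
  · simpa [prodDualPairing_apply] using h (0, f)
  · simpa [prodDualPairing_apply] using h (x, 0)


/-- Properties of a Manin triple of Rota-Baxter Lie algebras
`((g ⊕ g*, P ⊕ Q*), (g, P), (g*, Q*))`: (i) the adjoint of `P ⊕ Q*` w.r.t. the natural
pairing `B_d` is `Q ⊕ P*`, and `Q ⊕ P*` is admissible to `(g ⊕ g*, P ⊕ Q*)`;
(ii) `Q` is admissible to `(g, P)`; (iii) `P*` is admissible to `(g*, Q*)`. -/
theorem stmt11 (K : Type*) [Field K] [CharZero K] (lam : K)
    (g : Type*) [LieRing g] [LieAlgebra K g] [FiniteDimensional K g]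
    -- the Lie bracket on the dual space g*
    (bstar : Module.Dual K g →ₗ[K] Module.Dual K g →ₗ[K] Module.Dual K g)
    (hbstarAnti : ∀ a b : Module.Dual K g, bstar a b = -bstar b a)
    (hbstarJac : ∀ a b c : Module.Dual K g,
      bstar (bstar a b) c + bstar (bstar b c) a + bstar (bstar c a) b = 0)
    -- the Lie bracket on D = g ⊕ g*
    (br : (g × Module.Dual K g) →ₗ[K] (g × Module.Dual K g) →ₗ[K] (g × Module.Dual K g))
    (hbrAnti : ∀ u v, br u v = -br v u)
    (hbrJac : ∀ u v w, br (br u v) w + br (br v w) u + br (br w u) v = 0)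
    -- its restrictions to g and g* are the given brackets
    (hResg : ∀ x y : g, br (x, 0) (y, 0) = (⁅x, y⁆, 0))
    (hResgstar : ∀ a b : Module.Dual K g, br (0, a) (0, b) = (0, bstar a b))
    -- the natural bilinear form B_d is invariant
    (hBdInv : ∀ u v w : g × Module.Dual K g,
      (w.2 (br u v).1 + (br u v).2 w.1) = (br v w).2 u.1 + u.2 (br v w).1)
    (P Q : g →ₗ[K] g)
    -- P ⊕ Q* is a Rota-Baxter operator of weight lam on D
    (hRB : ∀ u v : g × Module.Dual K g,
      br (Prod.map (⇑P) (⇑Q.dualMap) u) (Prod.map (⇑P) (⇑Q.dualMap) v) =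
        Prod.map (⇑P) (⇑Q.dualMap) (br (Prod.map (⇑P) (⇑Q.dualMap) u) v) +
        Prod.map (⇑P) (⇑Q.dualMap) (br u (Prod.map (⇑P) (⇑Q.dualMap) v)) +
        lam • Prod.map (⇑P) (⇑Q.dualMap) (br u v)) :
    -- (i) the adjoint of P ⊕ Q* with respect to B_d is Q ⊕ P* ...
    (∀ u v : g × Module.Dual K g,
      v.2 (Prod.map (⇑P) (⇑Q.dualMap) u).1 + (Prod.map (⇑P) (⇑Q.dualMap) u).2 v.1 =
        (Prod.map (⇑Q) (⇑P.dualMap) v).2 u.1 + u.2 (Prod.map (⇑Q) (⇑P.dualMap) v).1) ∧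
    -- ... and Q ⊕ P* is admissible to (D, P ⊕ Q*)
    (∀ u v : g × Module.Dual K g,
      Prod.map (⇑Q) (⇑P.dualMap) (br (Prod.map (⇑P) (⇑Q.dualMap) u) v) -
        br (Prod.map (⇑P) (⇑Q.dualMap) u) (Prod.map (⇑Q) (⇑P.dualMap) v) -
        Prod.map (⇑Q) (⇑P.dualMap) (br u (Prod.map (⇑Q) (⇑P.dualMap) v)) -
        lam • br u (Prod.map (⇑Q) (⇑P.dualMap) v) = 0) ∧
    -- (ii) Q is admissible to (g, P)
    (∀ x y : g,
      Q ⁅P x, y⁆ - ⁅P x, Q y⁆ - Q ⁅x, Q y⁆ - lam • ⁅x, Q y⁆ = 0) ∧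
    -- (iii) P* is admissible to (g*, Q*)
    (∀ a b : Module.Dual K g,
      P.dualMap (bstar (Q.dualMap a) b) - bstar (Q.dualMap a) (P.dualMap b) -
        P.dualMap (bstar a (P.dualMap b)) - lam • bstar a (P.dualMap b) = 0) := by
  have hadj : ∀ u v : g × Module.Dual K g,
      prodDualPairing K g (Prod.map P Q.dualMap u) v =
        prodDualPairing K g u (Prod.map Q P.dualMap v) := fun _ _ => rfl
  have hadm := (prodDualPairing K g).admissible_of_adjoint_of_rotaBaxter prodDualPairing_symm
    eq_zero_of_prodDualPairing_eq_zero br hbrAnti hBdInv lam _ _ hadj hRB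
  refine ⟨hadj, hadm, fun x y => ?_, fun a b => ?_⟩
  · simpa [hResg] using congrArg Prod.fst (hadm (x, 0) (y, 0))
  · have h := hadm (0, a) (0, b)
    simp only [Prod.map_apply, map_zero, hResgstar] at h
    simpa only [Prod.snd_sub, Prod.smul_snd, Prod.snd_zero] using congrArg Prod.snd h
end

section
/- Let K be a field of characteristic zero, g a finite-dimensional Lie algebra over K, and suppose the dual space g* carries a Lie bracket such that the direct sum D = g ⊕ g* has a Lie bracket ⁅·,·⁆ restricting to the given brackets on g and g*, with the bilinear form B_d((x,a),(y,b)) = b(x) + a(y) invariant. Let P, Q : g → g be linear maps with transposes P*, Q* : g* → g*, and suppose P⊕Q* : (x,a) ↦ (P x, Q* a) is a Rota-Baxter operator of weight zero on D, so that (D, g, g*) is a Manin triple of Rota-Baxter Lie algebras of weight zero. Define, for u, v ∈ D, u ∘ v = ⁅(P⊕Q*)u, v⁆, u ◁ v = −(Q⊕P*)⁅u, v⁆, and u ▷ v = u ∘ v − u ◁ v, where Q⊕P* : (x,a) ↦ (Q x, P* a). Then (D, ▷, ◁) is a special L-dendriform algebra (◁ is antisymmetric and the two L-dendriform identities hold),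 and g and g* are closed under ▷ and ◁, with x ◁ y = −Q⁅x,y⁆_g, x ▷ y = ⁅P x, y⁆_g − x ◁ y on g, and a ◁ b = −P*⁅a,b⁆_{g*}, a ▷ b = ⁅Q* a, b⁆_{g*} − a ◁ b on g*. -/
section SpecialLDendriform

variable {K V : Type*} [CommRing K] [AddCommGroup V] [Module K V]
  {br : V →ₗ[K] V →ₗ[K] V} {S R : V →ₗ[K] V}

theorem leibniz_of_jacobi (hanti : ∀ u v, br u v = -br v u)
    (hjac : ∀ u v w, br (br u v) w + br (br v w) u + br (br w u) v = 0) (u v w : V) :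
    br (br u v) w = br u (br v w) - br v (br u w) := by
  have h := hjac u v w
  rw [hanti (br v w) u, hanti (br w u) v, hanti w u, map_neg, neg_neg] at h
  linear_combination (norm := module) h

/-- If `R` is the adjoint of a Rota-Baxter operator `S` for a nondegenerate invariant form, then
`R` is compatible with `S` in the sense that it represents the adjoint action of `(V, S)`. -/
theorem adjoint_compatible_of_rotaBaxter (B : V → V → K)
    (hadd : ∀ u v w, B u (v + w) = B u v + B u w)
    (hadd' : ∀ u v w, B (u + v) w = B u w + B v w)
    (hnondeg : ∀ v w, (∀ u, B u v = B u w) → v = w)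
    (hinv : ∀ u v w, B (br u v) w = B u (br v w))
    (hadj : ∀ u v, B (S u) v = B u (R v))
    (hRB : ∀ u v, br (S u) (S v) = S (br (S u) v) + S (br u (S v))) (v w : V) :
    R (br (S v) w) = R (br v (R w)) + br (S v) (R w) := by
  refine hnondeg _ _ fun u => ?_
  rw [hadd, ← hadj, ← hadj, ← hinv, ← hinv, ← hinv, hRB, hadd', hadj, hadj]

theorem lDendriform_left_identity
    (hleib : ∀ u v w, br (br u v) w = br u (br v w) - br v (br u w))
    (hanti : ∀ u v, br u v = -br v u)
    (hRB : ∀ u v, br (S u) (S v) = S (br (S u) v) + S (br u (S v)))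
    (hcompat : ∀ v w, R (br (S v) w) = R (br v (R w)) + br (S v) (R w))
    {d t : V → V → V} (hd : ∀ u v, d u v = -R (br u v))
    (ht : ∀ u v, t u v = br (S u) v - d u v) (u v w : V) :
    t (t u v) w + t (d u v) w + t v (t u w) - t (d v u) w - t (t v u) w -
      t u (t v w) = 0 := by
  have h1 := hleib (S u) (S v) w
  rw [hRB, map_add, LinearMap.add_apply, hanti u (S v), map_neg, map_neg,
    LinearMap.neg_apply] at h1
  have h2 := congrArg R (hleib (S u) v w)
  have h3 := congrArg R (hleib (S v) u w)
  have h4 := hcompat v (br u w)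
  have h5 := hcompat u (br v w)
  simp only [ht, hd, map_sub, map_neg, LinearMap.sub_apply,
    LinearMap.neg_apply] at h1 h2 h3 h4 h5 ⊢
  linear_combination (norm := module) h1 + h2 - h3 - h4 + h5

theorem lDendriform_right_identity
    (hleib : ∀ u v w, br (br u v) w = br u (br v w) - br v (br u w))
    (hanti : ∀ u v, br u v = -br v u)
    (hcompat : ∀ v w, R (br (S v) w) = R (br v (R w)) + br (S v) (R w))
    {d t : V → V → V} (hd : ∀ u v, d u v = -R (br u v))
    (ht : ∀ u v, t u v = br (S u) v - d u v) (u v w : V) :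
    d (t u v) w + d v (t u w) + d v (d u w) - d (d v u) w - t u (d v w) = 0 := by
  have h2 := congrArg R (hleib (S u) v w)
  have h5 := hcompat u (br v w)
  simp only [ht, hd, hanti v u, map_sub, map_neg,
    LinearMap.sub_apply, LinearMap.neg_apply] at h2 h5 ⊢
  linear_combination (norm := module) -h2 - h5

end SpecialLDendriform


/-- A Manin triple of Rota-Baxter Lie algebras of weight zero
`((g ⊕ g*, P ⊕ Q*), (g, P), (g*, Q*))` induces a special L-dendriform algebra on
`D = g ⊕ g*` via `u ∘ v = ⁅(P⊕Q*)u, v⁆`, `u ◁ v = -(Q⊕P*)⁅u,v⁆`,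
`u ▷ v = u ∘ v - u ◁ v`, with `g` and `g*` closed under `▷, ◁` and the stated
formulas on them. -/
theorem stmt12 (K : Type*) [Field K] [CharZero K]
    (g : Type*) [LieRing g] [LieAlgebra K g] [FiniteDimensional K g]
    (bstar : Module.Dual K g →ₗ[K] Module.Dual K g →ₗ[K] Module.Dual K g)
    (hbstarAnti : ∀ a b : Module.Dual K g, bstar a b = -bstar b a)
    (hbstarJac : ∀ a b c : Module.Dual K g,
      bstar (bstar a b) c + bstar (bstar b c) a + bstar (bstar c a) b = 0)
    (br : (g × Module.Dual K g) →ₗ[K] (g × Module.Dual K g) →ₗ[K] (g × Module.Dual K g))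
    (hbrAnti : ∀ u v, br u v = -br v u)
    (hbrJac : ∀ u v w, br (br u v) w + br (br v w) u + br (br w u) v = 0)
    (hResg : ∀ x y : g, br (x, 0) (y, 0) = (⁅x, y⁆, 0))
    (hResgstar : ∀ a b : Module.Dual K g, br (0, a) (0, b) = (0, bstar a b))
    (hBdInv : ∀ u v w : g × Module.Dual K g,
      (w.2 (br u v).1 + (br u v).2 w.1) = (br v w).2 u.1 + u.2 (br v w).1)
    (P Q : g →ₗ[K] g)
    (hRB : ∀ u v : g × Module.Dual K g,
      br (Prod.map (⇑P) (⇑Q.dualMap) u) (Prod.map (⇑P) (⇑Q.dualMap) v) =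
        Prod.map (⇑P) (⇑Q.dualMap) (br (Prod.map (⇑P) (⇑Q.dualMap) u) v) +
        Prod.map (⇑P) (⇑Q.dualMap) (br u (Prod.map (⇑P) (⇑Q.dualMap) v))) :
    let S : g × Module.Dual K g → g × Module.Dual K g := Prod.map (⇑P) (⇑Q.dualMap)
    let R : g × Module.Dual K g → g × Module.Dual K g := Prod.map (⇑Q) (⇑P.dualMap)
    let c : g × Module.Dual K g → g × Module.Dual K g → g × Module.Dual K g :=
      fun u v => br (S u) v
    let d : g × Module.Dual K g → g × Module.Dual K g → g × Module.Dual K g :=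
      fun u v => -R (br u v)
    let t : g × Module.Dual K g → g × Module.Dual K g → g × Module.Dual K g :=
      fun u v => c u v - d u v
    -- (D, ▷, ◁) is a special L-dendriform algebra
    (∀ u v, d u v = -(d v u)) ∧
    (∀ u v w,
      t (t u v) w + t (d u v) w + t v (t u w) - t (d v u) w - t (t v u) w -
        t u (t v w) = 0) ∧
    (∀ u v w,
      d (t u v) w + d v (t u w) + d v (d u w) - d (d v u) w - t u (d v w) = 0) ∧
    -- g is closed under ◁ and ▷, with the induced operations
    (∀ x y : g, d (x, 0) (y, 0) = (-Q ⁅x, y⁆, 0)) ∧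
    (∀ x y : g, t (x, 0) (y, 0) = (⁅P x, y⁆ - -Q ⁅x, y⁆, 0)) ∧
    -- g* is closed under ◁ and ▷, with the induced operations
    (∀ a b : Module.Dual K g, d (0, a) (0, b) = (0, -P.dualMap (bstar a b))) ∧
    (∀ a b : Module.Dual K g,
      t (0, a) (0, b) = (0, bstar (Q.dualMap a) b - -P.dualMap (bstar a b))) := by
  intro S R c d t
  have hleib := leibniz_of_jacobi hbrAnti hbrJac
  have hcompat : ∀ v w, (Q.prodMap P.dualMap) (br ((P.prodMap Q.dualMap) v) w) =
      (Q.prodMap P.dualMap) (br v ((Q.prodMap P.dualMap) w)) +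
        br ((P.prodMap Q.dualMap) v) ((Q.prodMap P.dualMap) w) := by
    refine adjoint_compatible_of_rotaBaxter (fun u v => v.2 u.1 + u.2 v.1) ?_ ?_ ?_ hBdInv ?_ hRB
    · intro u v w
      simp only [Prod.fst_add, Prod.snd_add, map_add, LinearMap.add_apply]
      ring
    · intro u v w
      simp only [Prod.fst_add, Prod.snd_add, map_add, LinearMap.add_apply]
      ring
    · intro v w h
      refine Prod.ext ?_ (LinearMap.ext fun x => by simpa using h (x, 0))
      rw [← sub_eq_zero, ← Module.forall_dual_apply_eq_zero_iff K]
      intro a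
      simpa [sub_eq_zero] using h (0, a)
    · intro u v
      simp
  have hd : ∀ u v, d u v = -(Q.prodMap P.dualMap) (br u v) := fun _ _ => rfl
  have ht : ∀ u v, t u v = br ((P.prodMap Q.dualMap) u) v - d u v := fun _ _ => rfl
  have hdg : ∀ x y : g, d (x, 0) (y, 0) = (-Q ⁅x, y⁆, 0) := by
    intro x y
    simp [hd, hResg]
  have hdgstar : ∀ a b : Module.Dual K g, d (0, a) (0, b) = (0, -P.dualMap (bstar a b)) := by
    intro a b
    simp [hd, hResgstar]
  refine ⟨fun u v => ?_, lDendriform_left_identity hleib hbrAnti hRB hcompat hd ht,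
    lDendriform_right_identity hleib hbrAnti hcompat hd ht, hdg, fun x y => ?_, hdgstar,
    fun a b => ?_⟩
  · rw [hd, hd, hbrAnti u v, map_neg]
  · rw [ht, hdg, LinearMap.prodMap_apply, map_zero, hResg, Prod.mk_sub_mk, sub_zero]
  · rw [ht, hdgstar, LinearMap.prodMap_apply, map_zero, hResgstar, Prod.mk_sub_mk, sub_zero]
end

section
/- Let K be a field of characteristic zero and λ ∈ K. Let (g, ⁅·,·⁆_g, P_g) and (h, ⁅·,·⁆_h, P_h) be Rota-Baxter Lie algebras of weight λ over K, and let ρ_g : g → End(h) and ρ_h : h → End(g) be Lie algebra representations forming a matched pair of Lie algebras (g, h, ρ_g, ρ_h), so that the bracket on g ⊕ h given by ⁅(x,a),(y,b)⁆ = (⁅x,y⁆_g + ρ_h(a)y − ρ_h(b)x, ⁅a,b⁆_h + ρ_g(x)b − ρ_g(y)a) is a Lie bracket. Then the map P_g⊕P_h : (x,a) ↦ (P_g x, P_h a) is a Rota-Baxter operator of weight λ on the Lie algebra g ⋈ h if and only if (ρ_g, P_h; h) is a representation of (g, P_g) and (ρ_h, P_g; g) is a representation of (h, P_h); that is, if and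 only if ρ_g(P_g x)(P_h a) = P_h(ρ_g(P_g x)a) + P_h(ρ_g(x)(P_h a)) + λ • P_h(ρ_g(x)a) and ρ_h(P_h a)(P_g x) = P_g(ρ_h(P_h a)x) + P_g(ρ_h(a)(P_g x)) + λ • P_g(ρ_h(a)x) for all x ∈ g, a ∈ h. -/
/-- Given Rota-Baxter Lie algebras `(g, P_g)` and `(h, P_h)` of weight `λ`
and a matched pair of Lie algebras `(g, h, ρ_g, ρ_h)`, the map `P_g ⊕ P_h` is a
Rota-Baxter operator of weight `λ` on `g ⋈ h` iff `(ρ_g, P_h; h)` is a representation of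
`(g, P_g)` and `(ρ_h, P_g; g)` is a representation of `(h, P_h)`. -/
theorem stmt13 (K : Type*) [Field K] [CharZero K] (lam : K)
    (g : Type*) [LieRing g] [LieAlgebra K g]
    (h : Type*) [LieRing h] [LieAlgebra K h]
    (Pg : g →ₗ[K] g)
    (hPg : ∀ x y : g, ⁅Pg x, Pg y⁆ = Pg ⁅Pg x, y⁆ + Pg ⁅x, Pg y⁆ + lam • Pg ⁅x, y⁆)
    (Ph : h →ₗ[K] h)
    (hPh : ∀ a b : h, ⁅Ph a, Ph b⁆ = Ph ⁅Ph a, b⁆ + Ph ⁅a, Ph b⁆ + lam • Ph ⁅a, b⁆)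
    (ρg : g →ₗ[K] Module.End K h)
    (hρg : ∀ x y : g, ρg ⁅x, y⁆ = ρg x * ρg y - ρg y * ρg x)
    (ρh : h →ₗ[K] Module.End K g)
    (hρh : ∀ a b : h, ρh ⁅a, b⁆ = ρh a * ρh b - ρh b * ρh a) :
    let br : g × h → g × h → g × h := fun p q =>
      (⁅p.1, q.1⁆ + ρh p.2 q.1 - ρh q.2 p.1, ⁅p.2, q.2⁆ + ρg p.1 q.2 - ρg q.1 p.2)
    -- matched pair: the bracket on g ⊕ h satisfies the Jacobi identity
    (∀ p q s : g × h, br (br p q) s + br (br q s) p + br (br s p) q = 0) →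
    -- the equivalence
    ((∀ p q : g × h,
        br (Prod.map (⇑Pg) (⇑Ph) p) (Prod.map (⇑Pg) (⇑Ph) q) =
          Prod.map (⇑Pg) (⇑Ph) (br (Prod.map (⇑Pg) (⇑Ph) p) q) +
          Prod.map (⇑Pg) (⇑Ph) (br p (Prod.map (⇑Pg) (⇑Ph) q)) +
          lam • Prod.map (⇑Pg) (⇑Ph) (br p q)) ↔
      ((∀ (x : g) (a : h),
          ρg (Pg x) (Ph a) =
            Ph (ρg (Pg x) a) + Ph (ρg x (Ph a)) + lam • Ph (ρg x a)) ∧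
        (∀ (a : h) (x : g),
          ρh (Ph a) (Pg x) =
            Pg (ρh (Ph a) x) + Pg (ρh a (Pg x)) + lam • Pg (ρh a x)))) := by
  intro br _
  constructor
  · intro hP
    refine ⟨fun x a => ?_, fun a x => ?_⟩
    · simpa [br] using congrArg Prod.snd (hP (x, 0) (0, a))
    · simpa [br] using congrArg Prod.fst (hP (0, a) (x, 0))
  · rintro ⟨hg, hh⟩ ⟨x, a⟩ ⟨y, b⟩
    ext
    · simp only [br, Prod.map_fst, Prod.map_snd, Prod.fst_add, Prod.smul_fst, map_add, map_sub,
        smul_add, smul_sub, hPg, hh]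
      abel
    · simp only [br, Prod.map_fst, Prod.map_snd, Prod.snd_add, Prod.smul_snd, map_add, map_sub,
        smul_add, smul_sub, hPh, hg]
      abel
end

section
/- Let K be a field of characteristic zero and A a finite-dimensional K-vector space. Let Δ, ∇ : A → A ⊗ A be linear maps with ∇ co-antisymmetric, i.e. τ ∘ ∇ = −∇ where τ is the flip on A ⊗ A. Define operations ▷, ◁ on the dual space A* by ⟨a* ▷ b*, x⟩ = ⟨a* ⊗ b*, Δ(x)⟩ and ⟨a* ◁ b*, x⟩ = ⟨a* ⊗ b*, ∇(x)⟩ for x ∈ A and a*, b* ∈ A*. Then (A, Δ, ∇) is a special L-dendriform coalgebra if and only if (A*, ▷, ◁) is a special L-dendriform algebra. -/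
open TensorProduct

section TensorPairing

variable {K M N L M' N' : Type*} [Field K]
  [AddCommGroup M] [Module K M] [AddCommGroup N] [Module K N] [AddCommGroup L] [Module K L]
  [AddCommGroup M'] [Module K M'] [AddCommGroup N'] [Module K N']

/-- The functional `f ⊗ h` on `M ⊗ N`, for functionals `f` on `M` and `h` on `N`. -/
def tensorPairing (f : Module.Dual K M) (h : Module.Dual K N) : Module.Dual K (M ⊗[K] N) :=
  TensorProduct.lift ((LinearMap.mul K K).compl₁₂ f h)

@[simp]
theorem tensorPairing_tmul (f : Module.Dual K M) (h : Module.Dual K N) (m : M) (n : N) :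
    tensorPairing f h (m ⊗ₜ n) = f m * h n := rfl

theorem tensorPairing_add_left (f f' : Module.Dual K M) (h : Module.Dual K N) :
    tensorPairing (f + f') h = tensorPairing f h + tensorPairing f' h := by
  ext; simp [add_mul]

theorem tensorPairing_add_right (f : Module.Dual K M) (h h' : Module.Dual K N) :
    tensorPairing f (h + h') = tensorPairing f h + tensorPairing f h' := by
  ext; simp [mul_add]

theorem tensorPairing_neg_left (f : Module.Dual K M) (h : Module.Dual K N) :
    tensorPairing (-f) h = -tensorPairing f h := by
  ext; simp

theorem tensorPairing_map (f : Module.Dual K M') (h : Module.Dual K N')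
    (u : M →ₗ[K] M') (v : N →ₗ[K] N') (w : M ⊗[K] N) :
    tensorPairing f h (TensorProduct.map u v w) = tensorPairing (f ∘ₗ u) (h ∘ₗ v) w := by
  rw [← LinearMap.comp_apply]
  congr 1
  ext; simp

theorem tensorPairing_comm (f : Module.Dual K M) (h : Module.Dual K N) (w : N ⊗[K] M) :
    tensorPairing f h (TensorProduct.comm K N M w) = tensorPairing h f w := by
  rw [← LinearEquiv.coe_coe, ← LinearMap.comp_apply]
  congr 1
  ext; simp [mul_comm]

theorem tensorPairing_assoc (f : Module.Dual K M) (h : Module.Dual K N) (k : Module.Dual K L)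
    (w : (M ⊗[K] N) ⊗[K] L) :
    tensorPairing f (tensorPairing h k) (TensorProduct.assoc K M N L w) =
      tensorPairing (tensorPairing f h) k w := by
  rw [← LinearEquiv.coe_coe, ← LinearMap.comp_apply]
  congr 1
  ext; simp [mul_assoc]

theorem tensorPairing_swap (f : Module.Dual K N) (h : Module.Dual K M) (k : Module.Dual K L)
    (w : M ⊗[K] (N ⊗[K] L)) :
    tensorPairing f (tensorPairing h k) (TensorProduct.assoc K N M L
      (TensorProduct.map (TensorProduct.comm K M N).toLinearMap LinearMap.id
        ((TensorProduct.assoc K M N L).symm w))) =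
      tensorPairing h (tensorPairing f k) w := by
  rw [tensorPairing_assoc, tensorPairing_map]
  have hcomm : tensorPairing f h ∘ₗ (TensorProduct.comm K M N).toLinearMap =
      tensorPairing h f := LinearMap.ext (tensorPairing_comm f h)
  rw [hcomm, LinearMap.comp_id, ← tensorPairing_assoc, LinearEquiv.apply_symm_apply]

theorem tensorPairing_triple_eq_zero_iff (w : M ⊗[K] (N ⊗[K] L)) :
    w = 0 ↔ ∀ (f : Module.Dual K M) (h : Module.Dual K N) (k : Module.Dual K L),
      tensorPairing f (tensorPairing h k) w = 0 := by
  refine ⟨fun hw f h k => by rw [hw, map_zero], fun hw => ?_⟩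
  let b := Module.Basis.ofVectorSpace K M
  let c := Module.Basis.ofVectorSpace K N
  let e := Module.Basis.ofVectorSpace K L
  refine (b.tensorProduct (c.tensorProduct e)).ext_elem fun ⟨i, j, l⟩ => ?_
  have hcoord : (b.tensorProduct (c.tensorProduct e)).coord (i, j, l) =
      tensorPairing (b.coord i) (tensorPairing (c.coord j) (e.coord l)) := by
    ext; simp [mul_comm]
  rw [map_zero, Finsupp.zero_apply, ← Module.Basis.coord_apply, hcoord, hw]

end TensorPairing

/-- For linear maps `Δ, ∇ : A → A ⊗ A` with `∇` co-antisymmetric,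
`(A, Δ, ∇)` is a special L-dendriform coalgebra iff the dual space `A*`, with the dual
operations `▷` and `◁` of `Δ` and `∇`, is a special L-dendriform algebra. -/
theorem stmt14 (K : Type*) [Field K] [CharZero K]
    (A : Type*) [AddCommGroup A] [Module K A] [FiniteDimensional K A]
    (Del nab : A →ₗ[K] A ⊗[K] A)
    (hco : ∀ x : A, (TensorProduct.comm K A A) (nab x) = -nab x) :
    let cop : A →ₗ[K] A ⊗[K] A := Del + nab
    let assoc := TensorProduct.assoc K A A A
    let τm : A ⊗[K] A →ₗ[K] A ⊗[K] A := (TensorProduct.comm K A A).toLinearMap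
    -- the flip of the first two factors of A ⊗ A ⊗ A
    let swap12 : A ⊗[K] (A ⊗[K] A) → A ⊗[K] (A ⊗[K] A) :=
      fun s => assoc (TensorProduct.map τm LinearMap.id (assoc.symm s))
    -- the natural pairing ⟨f ⊗ h, ·⟩ on A ⊗ A
    let pair : Module.Dual K A → Module.Dual K A → (A ⊗[K] A) →ₗ[K] K :=
      fun f h => TensorProduct.lift ((LinearMap.mul K K).compl₁₂ f h)
    -- the dual operations on A*
    let t : Module.Dual K A → Module.Dual K A → Module.Dual K A :=
      fun f h => (pair f h) ∘ₗ Del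
    let d : Module.Dual K A → Module.Dual K A → Module.Dual K A :=
      fun f h => (pair f h) ∘ₗ nab
    -- (A, Δ, ∇) is a special L-dendriform coalgebra ...
    ((∀ x : A,
        TensorProduct.map LinearMap.id nab (nab x) +
          swap12 (TensorProduct.map LinearMap.id cop (nab x)) +
          assoc (TensorProduct.map cop LinearMap.id (nab x)) -
          TensorProduct.map LinearMap.id nab (cop x) = 0) ∧
      (∀ x : A,
        assoc (TensorProduct.map cop LinearMap.id (cop x)) -
            TensorProduct.map LinearMap.id cop (cop x) =
          swap12 (assoc (TensorProduct.map cop LinearMap.id (cop x))) -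
            swap12 (TensorProduct.map LinearMap.id cop (cop x)))) ↔
    -- ... iff (A*, ▷, ◁) is a special L-dendriform algebra
    ((∀ f h : Module.Dual K A, d f h = -(d h f)) ∧
      (∀ f h k : Module.Dual K A,
        t (t f h) k + t (d f h) k + t h (t f k) - t (d h f) k - t (t h f) k -
          t f (t h k) = 0) ∧
      (∀ f h k : Module.Dual K A,
        d (t f h) k + d h (t f k) + d h (d f k) - d (d h f) k - t f (d h k) = 0)) := by
  intro cop assoc τm swap12 pair t d
  have pairing_left (u : A →ₗ[K] A ⊗[K] A) (f h k : Module.Dual K A) (w : A ⊗[K] A) :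
      tensorPairing f (tensorPairing h k) (assoc (TensorProduct.map u LinearMap.id w)) =
        tensorPairing (tensorPairing f h ∘ₗ u) k w := by
    rw [tensorPairing_assoc, tensorPairing_map, LinearMap.comp_id]
  have pairing_right (u : A →ₗ[K] A ⊗[K] A) (f h k : Module.Dual K A) (w : A ⊗[K] A) :
      tensorPairing f (tensorPairing h k) (TensorProduct.map LinearMap.id u w) =
        tensorPairing f (tensorPairing h k ∘ₗ u) w := by
    rw [tensorPairing_map, LinearMap.comp_id]
  have pairing_swap (f h k : Module.Dual K A) (w : A ⊗[K] (A ⊗[K] A)) :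
      tensorPairing f (tensorPairing h k) (swap12 w) = tensorPairing h (tensorPairing f k) w :=
    tensorPairing_swap f h k w
  have comp_cop (f h : Module.Dual K A) : tensorPairing f h ∘ₗ cop = t f h + d f h :=
    LinearMap.comp_add _ _ _
  have comp_nab (f h : Module.Dual K A) : tensorPairing f h ∘ₗ nab = d f h := rfl
  have pairing_Del (f h : Module.Dual K A) (x : A) : tensorPairing f h (Del x) = t f h x := rfl
  have pairing_nab (f h : Module.Dual K A) (x : A) : tensorPairing f h (nab x) = d f h x := rfl
  have pairing_cop (f h : Module.Dual K A) (x : A) :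
      tensorPairing f h (cop x) = t f h x + d f h x :=
    map_add (tensorPairing f h) (Del x) (nab x)
  have d_antisymm (f h : Module.Dual K A) : d f h = -d h f := by
    ext x
    rw [LinearMap.neg_apply, ← pairing_nab, ← pairing_nab, ← tensorPairing_comm, hco, map_neg]
  have t_add_left (f g h : Module.Dual K A) : t (f + g) h = t f h + t g h := by
    ext x; exact LinearMap.congr_fun (tensorPairing_add_left f g h) (Del x)
  have t_add_right (f g h : Module.Dual K A) : t f (g + h) = t f g + t f h := by
    ext x; exact LinearMap.congr_fun (tensorPairing_add_right f g h) (Del x)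
  have d_add_left (f g h : Module.Dual K A) : d (f + g) h = d f h + d g h := by
    ext x; exact LinearMap.congr_fun (tensorPairing_add_left f g h) (nab x)
  have d_add_right (f g h : Module.Dual K A) : d f (g + h) = d f g + d f h := by
    ext x; exact LinearMap.congr_fun (tensorPairing_add_right f g h) (nab x)
  have d_neg_left (f h : Module.Dual K A) : d (-f) h = -d f h := by
    ext x; exact LinearMap.congr_fun (tensorPairing_neg_left f h) (nab x)
  have nab_iff : (∀ x : A,
        TensorProduct.map LinearMap.id nab (nab x) +
          swap12 (TensorProduct.map LinearMap.id cop (nab x)) +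
          assoc (TensorProduct.map cop LinearMap.id (nab x)) -
          TensorProduct.map LinearMap.id nab (cop x) = 0) ↔
      ∀ f h k : Module.Dual K A,
        d (t f h) k + d h (t f k) + d h (d f k) - d (d h f) k - t f (d h k) = 0 := by
    simp only [tensorPairing_triple_eq_zero_iff, map_add, map_sub, pairing_left, pairing_right,
      pairing_swap, comp_cop, comp_nab, pairing_nab, pairing_cop, d_add_left, d_add_right,
      LinearMap.ext_iff, LinearMap.add_apply, LinearMap.sub_apply, LinearMap.zero_apply]
    have flip (f h k : Module.Dual K A) (x : A) : d (d h f) k x = -d (d f h) k x := by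
      rw [d_antisymm h f, d_neg_left, LinearMap.neg_apply]
    constructor
    · intro H f h k x
      linear_combination H x f h k - flip f h k x
    · intro H x f h k
      linear_combination H f h k x + flip f h k x
  have cop_iff : (∀ x : A,
        assoc (TensorProduct.map cop LinearMap.id (cop x)) -
            TensorProduct.map LinearMap.id cop (cop x) =
          swap12 (assoc (TensorProduct.map cop LinearMap.id (cop x))) -
            swap12 (TensorProduct.map LinearMap.id cop (cop x))) ↔
      ∀ (f h k : Module.Dual K A) (x : A),
        t (t f h + d f h) k x + d (t f h + d f h) k x -
            (t f (t h k + d h k) x + d f (t h k + d h k) x) =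
          t (t h f + d h f) k x + d (t h f + d h f) k x -
            (t h (t f k + d f k) x + d h (t f k + d f k) x) := by
    rw [forall_congr' fun x => sub_eq_zero.symm]
    simp only [tensorPairing_triple_eq_zero_iff, map_sub]
    simp only [pairing_left, pairing_right, pairing_swap, comp_cop, pairing_cop, sub_eq_zero]
    exact ⟨fun H f h k x => H x f h k, fun H x f h k => H f h k x⟩
  rw [nab_iff, cop_iff, and_iff_right d_antisymm, and_comm]
  refine and_congr_left fun H => ?_
  simp only [t_add_left, t_add_right, d_add_left, d_add_right, LinearMap.ext_iff,
    LinearMap.add_apply, LinearMap.sub_apply, LinearMap.zero_apply] at H ⊢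
  have flip (f h k : Module.Dual K A) (x : A) : d (d h f) k x = -d (d f h) k x := by
    rw [d_antisymm h f, d_neg_left, LinearMap.neg_apply]
  constructor
  · intro P f h k x
    linear_combination P f h k x - H f h k x + H h f k x - flip f h k x + flip h f k x
  · intro P f h k x
    linear_combination P f h k x + H f h k x - H h f k x + flip f h k x - flip h f k x
end

section
/- Let K be a field of characteristic zero and (g, ⁅·,·⁆, P, δ, Q) a Rota-Baxter Lie bialgebra of weight zero over K, with g finite-dimensional. Define on g the operations x ∘ y = ⁅P x, y⁆, x ◁ y = −Q⁅x, y⁆, x ▷ y = x ∘ y − x ◁ y, and the comultiplications ∇(x) = −δ(P x) and Δ(x) = (Q⊗id)δ(x) + δ(P x). Then (g, ▷, ◁, Δ, ∇) is a special L-dendriform bialgebra: (g, ▷, ◁) is a special L-dendriform algebra, (g, Δ, ∇) is a special L-dendriform coalgebra, and for all x, y ∈ g, with ◇ = Δ + ∇ and L_∘(x)y = x∘y, R_∘(y)x = x∘y, L_◁(x)y = x◁y, L_▷(x)y = x▷y, ⁅x,y⁆' = x∘y − y∘x, the three compatibility conditions hold: ◇(x ∘ y) − (id⊗R_∘(y))Δ(x)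 + (L_◁(y)⊗id)∇(x) − (L_▷(x)⊗id + id⊗L_∘(x))◇(y) = 0; (τ − id)((id⊗L_◁(x))◇(y) − (id⊗L_◁(y))◇(x) − ◇(x ◁ y)) = 0; and ∇(⁅x,y⁆') + (L_∘(y)⊗id + id⊗L_∘(y))∇(x) − (L_∘(x)⊗id + id⊗L_∘(x))∇(y) = 0. -/
open TensorProduct

/-- The comultiplication form of the co-Jacobi identity: `(δ ⊗ id)δ = (id ⊗ δ)δ - (τ ⊗ id)(id ⊗ δ)δ`
for a co-antisymmetric `δ` satisfying the cyclic co-Jacobi identity. -/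
theorem assoc_map_comul_id_of_coJacobi {K : Type*} [Field K] {g : Type*} [AddCommGroup g] [Module K g]
    (δ : g →ₗ[K] g ⊗[K] g)
    (hanti : ∀ x : g, TensorProduct.comm K g g (δ x) = -δ x) (x : g)
    (hJac : (TensorProduct.map LinearMap.id δ (δ x)) +
        (TensorProduct.comm K (g ⊗[K] g) g)
          ((TensorProduct.assoc K g g g).symm (TensorProduct.map LinearMap.id δ (δ x))) +
        (TensorProduct.comm K (g ⊗[K] g) g)
          ((TensorProduct.assoc K g g g).symm
            ((TensorProduct.comm K (g ⊗[K] g) g)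
              ((TensorProduct.assoc K g g g).symm
                (TensorProduct.map LinearMap.id δ (δ x))))) = 0) :
    TensorProduct.assoc K g g g (TensorProduct.map δ LinearMap.id (δ x)) =
      TensorProduct.map LinearMap.id δ (δ x) -
        TensorProduct.assoc K g g g (TensorProduct.map (TensorProduct.comm K g g).toLinearMap
          LinearMap.id ((TensorProduct.assoc K g g g).symm
            (TensorProduct.map LinearMap.id δ (δ x)))) := by
  have cyclic_eq : ∀ s : g ⊗[K] g,
      TensorProduct.comm K (g ⊗[K] g) g ((TensorProduct.assoc K g g g).symm
        (TensorProduct.comm K (g ⊗[K] g) g ((TensorProduct.assoc K g g g).symm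
          (TensorProduct.map LinearMap.id δ s)))) =
      TensorProduct.assoc K g g g (TensorProduct.map δ LinearMap.id
        (TensorProduct.comm K g g s)) := by
    intro s
    induction s using TensorProduct.induction_on with
    | zero => simp
    | add a b ha hb => simp only [map_add, ha, hb]
    | tmul u v =>
      simp only [TensorProduct.map_tmul, TensorProduct.comm_tmul, LinearMap.id_apply]
      induction δ v using TensorProduct.induction_on with
      | zero => simp
      | add a b ha hb => simp only [TensorProduct.tmul_add, TensorProduct.add_tmul, map_add, ha, hb]
      | tmul a b => simp
  have swap_eq : ∀ s : g ⊗[K] (g ⊗[K] g),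
      TensorProduct.comm K (g ⊗[K] g) g ((TensorProduct.assoc K g g g).symm s) =
      TensorProduct.assoc K g g g (TensorProduct.map (TensorProduct.comm K g g).toLinearMap
        LinearMap.id ((TensorProduct.assoc K g g g).symm
          (TensorProduct.map LinearMap.id (TensorProduct.comm K g g).toLinearMap s))) := by
    intro s
    induction s using TensorProduct.induction_on with
    | zero => simp
    | add a b ha hb => simp only [map_add, ha, hb]
    | tmul u v =>
      induction v using TensorProduct.induction_on with
      | zero => simp
      | add a b ha hb => simp only [TensorProduct.tmul_add, map_add, ha, hb]
      | tmul a b => simp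
  have anti_right : ∀ s : g ⊗[K] g,
      TensorProduct.map LinearMap.id (TensorProduct.comm K g g).toLinearMap
        (TensorProduct.map LinearMap.id δ s) = -TensorProduct.map LinearMap.id δ s := by
    intro s
    induction s using TensorProduct.induction_on with
    | zero => simp
    | add a b ha hb => simp only [map_add, ha, hb, neg_add]
    | tmul u v => simp [hanti, TensorProduct.tmul_neg]
  rw [cyclic_eq, hanti, swap_eq, anti_right] at hJac
  simp only [map_neg] at hJac
  rw [← sub_eq_add_neg, ← sub_eq_add_neg, sub_eq_zero] at hJac
  exact hJac.symm

/-- The tensor product of two maps is odd in the first one. -/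
theorem map_neg_left_apply {K : Type*} [Field K] {g : Type*} [AddCommGroup g] [Module K g]
    (A B : g →ₗ[K] g) (s : g ⊗[K] g) :
    TensorProduct.map (-A) B s = -TensorProduct.map A B s := by
  rw [← LinearMap.neg_apply]
  congr 1
  ext u v
  simp [TensorProduct.neg_tmul]

/-- The tensor product of two maps is odd in the second one. -/
theorem map_neg_right_apply {K : Type*} [Field K] {g : Type*} [AddCommGroup g] [Module K g]
    {M : Type*} [AddCommGroup M] [Module K M] (A : g →ₗ[K] g) (B : g →ₗ[K] M) (s : g ⊗[K] g) :
    TensorProduct.map A (-B) s = -TensorProduct.map A B s := by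
  rw [← LinearMap.neg_apply]
  congr 1
  ext u v
  simp [TensorProduct.tmul_neg]

/-- Exchanging the first two tensor factors carries operators along. -/
theorem swap_map_map_id {K : Type*} [Field K] {g : Type*} [AddCommGroup g] [Module K g]
    (A B : g →ₗ[K] g) (s : g ⊗[K] (g ⊗[K] g)) :
    TensorProduct.assoc K g g g (TensorProduct.map (TensorProduct.comm K g g).toLinearMap
      LinearMap.id ((TensorProduct.assoc K g g g).symm
        (TensorProduct.map A (TensorProduct.map B LinearMap.id) s))) =
    TensorProduct.map B (TensorProduct.map A LinearMap.id)
      (TensorProduct.assoc K g g g (TensorProduct.map (TensorProduct.comm K g g).toLinearMap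
        LinearMap.id ((TensorProduct.assoc K g g g).symm s))) := by
  induction s using TensorProduct.induction_on with
  | zero => simp
  | add a b ha hb => simp only [map_add, ha, hb]
  | tmul u v =>
    induction v using TensorProduct.induction_on with
    | zero => simp
    | add a b ha hb => simp only [TensorProduct.tmul_add, map_add, ha, hb]
    | tmul a b => simp

/-- A Rota-Baxter Lie bialgebra `(g, ⁅·,·⁆, P, δ, Q)` of weight zero
induces a special L-dendriform bialgebra `(g, ▷, ◁, Δ, ∇)` with `x ∘ y = ⁅P x, y⁆`,
`x ◁ y = -Q⁅x,y⁆`, `x ▷ y = x ∘ y - x ◁ y`, `∇(x) = -δ(P x)` and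
`Δ(x) = (Q ⊗ id)δ(x) + δ(P x)`. -/
theorem stmt15 (K : Type*) [Field K] [CharZero K]
    (g : Type*) [LieRing g] [LieAlgebra K g] [FiniteDimensional K g]
    (δ : g →ₗ[K] g ⊗[K] g) (P Q : g →ₗ[K] g)
    -- (1) (g, ⁅·,·⁆, δ) is a Lie bialgebra:
    (hcoanti : ∀ x : g, (TensorProduct.comm K g g) (δ x) = -δ x)
    (hcoJac : ∀ x : g,
      (TensorProduct.map LinearMap.id δ (δ x)) +
        (TensorProduct.comm K (g ⊗[K] g) g)
          ((TensorProduct.assoc K g g g).symm (TensorProduct.map LinearMap.id δ (δ x))) +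
        (TensorProduct.comm K (g ⊗[K] g) g)
          ((TensorProduct.assoc K g g g).symm
            ((TensorProduct.comm K (g ⊗[K] g) g)
              ((TensorProduct.assoc K g g g).symm
                (TensorProduct.map LinearMap.id δ (δ x))))) = 0)
    (hcocycle : ∀ x y : g,
      δ ⁅x, y⁆ =
        ((TensorProduct.map (LieAlgebra.ad K g x : Module.End K g) LinearMap.id +
          TensorProduct.map LinearMap.id (LieAlgebra.ad K g x : Module.End K g) :
            g ⊗[K] g →ₗ[K] g ⊗[K] g)) (δ y) -
        ((TensorProduct.map (LieAlgebra.ad K g y : Module.End K g) LinearMap.id +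
          TensorProduct.map LinearMap.id (LieAlgebra.ad K g y : Module.End K g) :
            g ⊗[K] g →ₗ[K] g ⊗[K] g)) (δ x))
    -- (2) P is a Rota-Baxter operator of weight zero:
    (hP : ∀ x y : g, ⁅P x, P y⁆ = P ⁅P x, y⁆ + P ⁅x, P y⁆)
    -- (3) Q is a Rota-Baxter operator of weight zero on the Lie coalgebra (g, δ):
    (hQ : ∀ x : g,
      TensorProduct.map Q Q (δ x) =
        ((TensorProduct.map Q LinearMap.id + TensorProduct.map LinearMap.id Q :
            g ⊗[K] g →ₗ[K] g ⊗[K] g)) (δ (Q x)))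
    -- (4) Q is admissible to (g, P):
    (hadm : ∀ x y : g, Q ⁅P x, y⁆ - ⁅P x, Q y⁆ - Q ⁅x, Q y⁆ = 0)
    -- (5) P* is admissible to (g*, δ*, Q*):
    (hPadm : ∀ x : g,
      TensorProduct.map P Q (δ x) +
        ((TensorProduct.map P LinearMap.id - TensorProduct.map LinearMap.id Q :
            g ⊗[K] g →ₗ[K] g ⊗[K] g)) (δ (P x)) = 0) :
    -- the induced operations and co-operations
    let c : g → g → g := fun x y => ⁅P x, y⁆
    let d : g → g → g := fun x y => -Q ⁅x, y⁆
    let t : g → g → g := fun x y => c x y - d x y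
    let nab : g →ₗ[K] g ⊗[K] g := -(δ ∘ₗ P)
    let Del : g →ₗ[K] g ⊗[K] g := (TensorProduct.map Q LinearMap.id) ∘ₗ δ + δ ∘ₗ P
    let cop : g →ₗ[K] g ⊗[K] g := Del + nab
    let assoc := TensorProduct.assoc K g g g
    let τm : g ⊗[K] g →ₗ[K] g ⊗[K] g := (TensorProduct.comm K g g).toLinearMap
    let swap12 : g ⊗[K] (g ⊗[K] g) → g ⊗[K] (g ⊗[K] g) :=
      fun s => assoc (TensorProduct.map τm LinearMap.id (assoc.symm s))
    let Lc : g → Module.End K g := fun x => LieAlgebra.ad K g (P x)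
    let Rc : g → Module.End K g := fun y => -((LieAlgebra.ad K g y : Module.End K g) ∘ₗ P)
    let Ld : g → Module.End K g := fun x => -(Q ∘ₗ (LieAlgebra.ad K g x : Module.End K g))
    let Lt : g → Module.End K g := fun x => Lc x - Ld x
    -- (g, ▷, ◁) is a special L-dendriform algebra
    ((∀ x y : g, d x y = -(d y x)) ∧
      (∀ x y z : g,
        t (t x y) z + t (d x y) z + t y (t x z) - t (d y x) z - t (t y x) z -
          t x (t y z) = 0) ∧
      (∀ x y z : g,
        d (t x y) z + d y (t x z) + d y (d x z) - d (d y x) z - t x (d y z) = 0)) ∧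
    -- (g, Δ, ∇) is a special L-dendriform coalgebra
    ((∀ x : g, (TensorProduct.comm K g g) (nab x) = -nab x) ∧
      (∀ x : g,
        TensorProduct.map LinearMap.id nab (nab x) +
          swap12 (TensorProduct.map LinearMap.id cop (nab x)) +
          assoc (TensorProduct.map cop LinearMap.id (nab x)) -
          TensorProduct.map LinearMap.id nab (cop x) = 0) ∧
      (∀ x : g,
        assoc (TensorProduct.map cop LinearMap.id (cop x)) -
            TensorProduct.map LinearMap.id cop (cop x) =
          swap12 (assoc (TensorProduct.map cop LinearMap.id (cop x))) -
            swap12 (TensorProduct.map LinearMap.id cop (cop x)))) ∧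
    -- the three compatibility conditions
    (∀ x y : g,
      cop (c x y) - TensorProduct.map LinearMap.id (Rc y) (Del x) +
        TensorProduct.map (Ld y) LinearMap.id (nab x) -
        ((TensorProduct.map (Lt x) LinearMap.id +
          TensorProduct.map LinearMap.id (Lc x) :
            g ⊗[K] g →ₗ[K] g ⊗[K] g)) (cop y) = 0) ∧
    (∀ x y : g,
      (TensorProduct.comm K g g)
          (TensorProduct.map LinearMap.id (Ld x) (cop y) -
            TensorProduct.map LinearMap.id (Ld y) (cop x) - cop (d x y)) -
        (TensorProduct.map LinearMap.id (Ld x) (cop y) -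
          TensorProduct.map LinearMap.id (Ld y) (cop x) - cop (d x y)) = 0) ∧
    (∀ x y : g,
      nab (c x y - c y x) +
        ((TensorProduct.map (Lc y) LinearMap.id +
          TensorProduct.map LinearMap.id (Lc y) :
            g ⊗[K] g →ₗ[K] g ⊗[K] g)) (nab x) -
        ((TensorProduct.map (Lc x) LinearMap.id +
          TensorProduct.map LinearMap.id (Lc x) :
            g ⊗[K] g →ₗ[K] g ⊗[K] g)) (nab y) = 0) := by
  intro c d t nab Del cop assoc τm swap12 Lc Rc Ld Lt
  have hcop : ∀ x, cop x = TensorProduct.map Q LinearMap.id (δ x) := by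
    intro x; simp [cop, Del, nab]
  have hcop' : cop = TensorProduct.map Q LinearMap.id ∘ₗ δ := LinearMap.ext hcop
  have hnab : ∀ x, nab x = -δ (P x) := fun x => rfl
  have hcoJ := fun x => assoc_map_comul_id_of_coJacobi δ hcoanti x (hcoJac x)
  have hQx : ∀ x y : g, ⁅P x, Q y⁆ + Q ⁅x, Q y⁆ = Q ⁅P x, y⁆ := by
    intro x y
    rw [eq_comm, ← sub_eq_zero, ← hadm x y]; abel
  have hPw : ∀ x y : g, P (c x y - c y x) = ⁅P x, P y⁆ := by
    intro x y
    simp only [c]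
    rw [hP, map_sub, ← lie_skew (P y) x, map_neg]
    rw [← lie_skew x (P y)]; simp
  have hcm : ∀ (A B : g →ₗ[K] g) (z : g), TensorProduct.comm K g g (TensorProduct.map A B (δ z)) =
      -TensorProduct.map B A (δ z) := by
    intro A B z
    rw [← TensorProduct.map_comm, hcoanti, map_neg]
  have hQop : ∀ x : g, Q ∘ₗ (LieAlgebra.ad K g (P x) : Module.End K g) =
      (LieAlgebra.ad K g (P x) : Module.End K g) ∘ₗ Q +
        (Q ∘ₗ (LieAlgebra.ad K g x : Module.End K g)) ∘ₗ Q :=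
    fun x => LinearMap.ext fun y => (hQx x y).symm
  -- The second factor version of the admissibility of the dual operators.
  have hPadm' : ∀ x : g, TensorProduct.map Q P (δ x) + TensorProduct.map LinearMap.id P (δ (P x)) =
      TensorProduct.map Q LinearMap.id (δ (P x)) := by
    intro x
    have h := congrArg (TensorProduct.comm K g g) (hPadm x)
    simp only [LinearMap.sub_apply, map_add, map_sub, hcm, map_zero] at h
    rw [← sub_eq_zero, ← neg_eq_zero, ← h]
    abel
  refine ⟨⟨?_, ?_, ?_⟩, ⟨?_, ?_, ?_⟩, ?_, ?_, ?_⟩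
  · intro x y
    simp only [d]
    rw [← lie_skew x y, map_neg]
  · intro x y z
    have h1 : t (t x y) z + t (d x y) z - t (d y x) z - t (t y x) z = t (c x y - c y x) z := by
      simp only [t, c, d, map_sub, map_neg, sub_lie, neg_lie]
      abel
    have h2 : ∀ x y : g, t y (t x z) = ⁅P y, ⁅P x, z⁆⁆ + Q (⁅y, ⁅P x, z⁆⁆ + ⁅P y, ⁅x, z⁆⁆) := by
      intro x y
      simp only [t, c, d, sub_neg_eq_add, lie_add, map_add, ← hQx]
      abel
    have h3 : t (c x y - c y x) z =
        ⁅⁅P x, P y⁆, z⁆ + Q (⁅⁅P x, y⁆, z⁆ - ⁅⁅P y, x⁆, z⁆) := by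
      simp only [t]
      simp only [d, sub_neg_eq_add]
      congr 1
      · rw [← hPw]
      · simp only [c, sub_lie]
    have h4 : t (t x y) z + t (d x y) z + t y (t x z) - t (d y x) z - t (t y x) z - t x (t y z) =
        (t (t x y) z + t (d x y) z - t (d y x) z - t (t y x) z) + t y (t x z) - t x (t y z) := by
      abel
    rw [h4, h1, h3, h2, h2]
    simp only [lie_lie, map_add, map_sub]
    abel
  · intro x y z
    simp only [t, c, d, map_sub, map_neg, sub_lie, neg_lie, lie_sub, lie_neg,
      lie_lie, ← hQx]
    rw [← lie_skew y x]
    simp only [map_neg, neg_lie]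
    abel
  · intro x
    rw [hnab, map_neg, hcoanti]
  · intro x
    have e1 : TensorProduct.map LinearMap.id nab (nab x) - TensorProduct.map LinearMap.id nab (cop x) =
        TensorProduct.map Q LinearMap.id (TensorProduct.map LinearMap.id δ (δ (P x))) := by
      have h := congrArg (TensorProduct.map LinearMap.id δ) (hPadm' x)
      simp only [map_add, TensorProduct.map_map, LinearMap.id_comp, LinearMap.comp_id] at h ⊢
      rw [← h, hcop, hnab]
      simp only [nab, TensorProduct.map_map, LinearMap.id_comp, LinearMap.comp_id, map_neg]
      simp only [map_neg_right_apply]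
      abel
    have e2 : swap12 (TensorProduct.map LinearMap.id cop (nab x)) =
        -TensorProduct.map Q LinearMap.id (swap12 (TensorProduct.map LinearMap.id δ (δ (P x)))) := by
      have h := swap_map_map_id LinearMap.id Q (TensorProduct.map LinearMap.id δ (δ (P x)))
      simp only [TensorProduct.map_id, TensorProduct.map_map, LinearMap.id_comp] at h
      simp only [swap12, hnab, map_neg, hcop']
      exact congrArg _ h
    have e3 : assoc (TensorProduct.map cop LinearMap.id (nab x)) =
        -TensorProduct.map Q LinearMap.id (assoc (TensorProduct.map δ LinearMap.id (δ (P x)))) := by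
      rw [hnab, map_neg, map_neg, hcop']
      congr 1
      have h := TensorProduct.map_map_assoc Q LinearMap.id LinearMap.id
        (TensorProduct.map δ LinearMap.id (δ (P x)))
      simp only [TensorProduct.map_id, TensorProduct.map_map, LinearMap.id_comp] at h
      exact h.symm
    have e4 := congrArg (TensorProduct.map Q LinearMap.id) (hcoJ (P x))
    rw [map_sub] at e4
    have e5 : ∀ a b c d : g ⊗[K] (g ⊗[K] g), a + b + c - d = (a - d) + b + c := by
      intros; abel
    rw [e5, e1, e2, e3, e4]
    simp only [swap12, assoc, τm]
    abel
  · intro x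
    have f1 : TensorProduct.map LinearMap.id cop (cop x) =
        TensorProduct.map Q (TensorProduct.map Q LinearMap.id)
          (TensorProduct.map LinearMap.id δ (δ x)) := by
      rw [hcop, hcop']
      simp only [TensorProduct.map_map, LinearMap.id_comp, LinearMap.comp_id]
    have f2 : ∀ s : g ⊗[K] g,
        assoc (TensorProduct.map cop LinearMap.id (TensorProduct.map Q LinearMap.id s)) -
          swap12 (assoc (TensorProduct.map cop LinearMap.id (TensorProduct.map Q LinearMap.id s))) =
        TensorProduct.map Q (TensorProduct.map Q LinearMap.id)
          (assoc (TensorProduct.map δ LinearMap.id s)) := by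
      intro s
      simp only [swap12, LinearEquiv.symm_apply_apply]
      induction s using TensorProduct.induction_on with
      | zero => simp
      | add a b ha hb =>
        simp only [map_add, ← ha, ← hb]
        abel
      | tmul u v =>
        have h := hQ u
        have h' : cop (Q u) - τm (cop (Q u)) = TensorProduct.map Q Q (δ u) := by
          rw [h, hcop]
          simp only [τm, LinearEquiv.coe_coe, hcm,
            LinearMap.add_apply, sub_neg_eq_add]
        simp only [TensorProduct.map_tmul, LinearMap.id_apply]
        rw [← map_sub, ← TensorProduct.sub_tmul, h']
        have h2 := TensorProduct.map_map_assoc Q Q LinearMap.id (δ u ⊗ₜ[K] v)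
        rw [h2]
        rfl
    have f3 := swap_map_map_id Q Q (TensorProduct.map LinearMap.id δ (δ x))
    have f4 := congrArg (TensorProduct.map Q (TensorProduct.map Q LinearMap.id)) (hcoJ x)
    rw [map_sub] at f4
    have f5 := f2 (δ x)
    rw [← hcop, f4, ← f3, ← f1] at f5
    rw [sub_eq_sub_iff_sub_eq_sub]
    exact f5
  · intro x y
    have h := congrArg (TensorProduct.map LinearMap.id (LieAlgebra.ad K g y : Module.End K g))
      (hPadm' x)
    simp only [map_add, TensorProduct.map_map, LinearMap.id_comp, LinearMap.comp_id] at h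
    rw [hcop, hcop]
    simp only [c, Del, hnab, hcocycle, Rc, Ld, Lt, Lc, LinearMap.add_apply, map_sub, map_add,
      map_neg, LinearMap.comp_apply, map_neg_left_apply, map_neg_right_apply, sub_neg_eq_add,
      TensorProduct.map_map, LinearMap.id_comp, LinearMap.comp_id, hQop,
      TensorProduct.map_add_left, ← h]
    abel
  · intro x y
    have h := congrArg (TensorProduct.map Q Q) (hcocycle x y)
    rw [hQ] at h
    simp only [map_add, map_sub, LinearMap.add_apply, TensorProduct.map_map, LinearMap.comp_id] at h
    simp only [hcop, d, Ld, map_sub, map_neg, map_neg_right_apply, TensorProduct.map_map,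
      LinearMap.id_comp, LinearMap.comp_id, hcm]
    rw [← sub_eq_zero] at h
    rw [← neg_eq_zero, ← h]
    abel
  · intro x y
    rw [hnab, hPw, hnab, hnab, hcocycle]
    simp only [map_neg]
    abel
end

section
/- Let K be a field of characteristic zero, λ ∈ K, (g, P) a Rota-Baxter Lie algebra of weight λ over K, ρ : g → End(V) a representation of the Lie algebra g, and Q : g → g, α, β : V → V linear maps. Equip g ⊕ V with the semi-direct product Lie bracket ⁅(x,u),(y,v)⁆ = (⁅x,y⁆, ρ(x)v − ρ(y)u). Then the following are equivalent: (a) P⊕α : (x,u) ↦ (P x, α u) is a Rota-Baxter operator of weight λ on g ⋉_ρ V and Q⊕β : (x,u) ↦ (Q x, β u) is admissible to the Rota-Baxter Lie algebra (g ⋉_ρ V, P⊕α); (b) the following four conditions hold: (i) ρ(P x)(α v) = α(ρ(P x)v) + α(ρ(x)(α v)) + λ•α(ρ(x)v) for all x ∈ g, v ∈ V; (ii) Q⁅P x, y⁆ − ⁅P x, Q y⁆ − Q⁅x, Q y⁆ − λ•⁅x, Q y⁆ = 0 for all x, y ∈ g; (iii) β(ρ(P x)v) − ρ(P x)(β v)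 − β(ρ(x)(β v)) − λ•ρ(x)(β v) = 0 for all x ∈ g, v ∈ V; (iv) β(ρ(x)(α v)) = β(ρ(Q x)v) + ρ(Q x)(α v) + λ•ρ(Q x)v for all x ∈ g, v ∈ V. -/
/-- For a Rota-Baxter Lie algebra `(g, P)` of weight `λ`, a representation
`ρ` of `g` on `V` and linear maps `Q, α, β`, the pair `(P⊕α` is Rota-Baxter on `g ⋉_ρ V`
and `Q⊕β` admissible to it`)` is equivalent to the four conditions (i)-(iv). -/
theorem stmt17 (K : Type*) [Field K] [CharZero K] (lam : K)
    (g : Type*) [LieRing g] [LieAlgebra K g]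
    (V : Type*) [AddCommGroup V] [Module K V]
    (P : g →ₗ[K] g)
    (hP : ∀ x y : g, ⁅P x, P y⁆ = P ⁅P x, y⁆ + P ⁅x, P y⁆ + lam • P ⁅x, y⁆)
    (ρ : g →ₗ[K] Module.End K V)
    (hρ : ∀ x y : g, ρ ⁅x, y⁆ = ρ x * ρ y - ρ y * ρ x)
    (Q : g →ₗ[K] g) (α β : V →ₗ[K] V) :
    let br : g × V → g × V → g × V :=
      fun p q => (⁅p.1, q.1⁆, ρ p.1 q.2 - ρ q.1 p.2)
    let S : g × V → g × V := Prod.map (⇑P) (⇑α)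
    let R : g × V → g × V := Prod.map (⇑Q) (⇑β)
    -- (a): P⊕α is Rota-Baxter on g ⋉ V and Q⊕β is admissible to (g ⋉ V, P⊕α)
    ((∀ p q : g × V,
        br (S p) (S q) = S (br (S p) q) + S (br p (S q)) + lam • S (br p q)) ∧
      (∀ p q : g × V,
        R (br (S p) q) - br (S p) (R q) - R (br p (R q)) - lam • br p (R q) = 0)) ↔
    -- (b): the four conditions
    ((∀ (x : g) (v : V),
        ρ (P x) (α v) = α (ρ (P x) v) + α (ρ x (α v)) + lam • α (ρ x v)) ∧
      (∀ x y : g, Q ⁅P x, y⁆ - ⁅P x, Q y⁆ - Q ⁅x, Q y⁆ - lam • ⁅x, Q y⁆ = 0) ∧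
      (∀ (x : g) (v : V),
        β (ρ (P x) v) - ρ (P x) (β v) - β (ρ x (β v)) - lam • ρ x (β v) = 0) ∧
      (∀ (x : g) (v : V),
        β (ρ x (α v)) = β (ρ (Q x) v) + ρ (Q x) (α v) + lam • ρ (Q x) v)) := by
  intro br S R
  constructor
  · rintro ⟨hRB, hadm⟩
    refine ⟨fun x v => ?_, fun x y => ?_, fun x v => ?_, fun x v => ?_⟩
    · simpa [br, S] using congrArg Prod.snd (hRB (x, 0) (0, v))
    · simpa [br, S, R] using congrArg Prod.fst (hadm (x, 0) (y, 0))
    · simpa [br, S, R] using congrArg Prod.snd (hadm (x, 0) (0, v))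
    · have h := congrArg Prod.snd (hadm (0, v) (x, 0))
      simp [br, S, R] at h
      rw [← sub_eq_zero, ← neg_eq_zero, ← h]
      abel
  · rintro ⟨hα, hQ, hβ, hβα⟩
    refine ⟨fun ⟨x, u⟩ ⟨y, v⟩ => Prod.ext ?_ ?_, fun ⟨x, u⟩ ⟨y, v⟩ => Prod.ext ?_ ?_⟩
    · exact hP x y
    · simp only [br, S, Prod.map_apply, Prod.snd_add, Prod.smul_snd, map_sub, smul_sub, hα]
      abel
    · exact hQ x y
    · have h := hβ x v
      simp only [br, S, R, Prod.map_apply, Prod.snd_sub, Prod.smul_snd, Prod.snd_zero, map_sub,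
        smul_sub, hβα]
      rw [← h]
      abel
end

section
/- Let K be a field of characteristic zero, λ ∈ K, (g, P) a Rota-Baxter Lie algebra of weight λ over K, and (ρ, α; V) a representation of (g, P). Let T : V → g be an O-operator of (g, P) associated to (ρ, α; V), i.e. a linear map satisfying ⁅T u, T v⁆ = T(ρ(T u)v − ρ(T v)u) for all u, v ∈ V and P ∘ T = T ∘ α. Then the product u ∘ v := ρ(T u)v makes V a pre-Lie algebra, i.e. (u∘v)∘w − u∘(v∘w) = (v∘u)∘w − v∘(u∘w) for all u,v,w ∈ V, and α is a Rota-Baxter operator of weight λ on (V, ∘), i.e. α(u)∘α(v) = α(α(u)∘v) + α(u∘α(v)) + λ•α(u∘v) for all u, v ∈ V. -/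
/-- If `T : V → g` is an O-operator of a Rota-Baxter Lie algebra `(g, P)`
of weight `λ` associated to a representation `(ρ, α; V)`, then `u ∘ v = ρ (T u) v` is a
pre-Lie product on `V` and `α` is a Rota-Baxter operator of weight `λ` on `(V, ∘)`. -/
theorem stmt19 (K : Type*) [Field K] [CharZero K] (lam : K)
    (g : Type*) [LieRing g] [LieAlgebra K g]
    (V : Type*) [AddCommGroup V] [Module K V]
    (P : g →ₗ[K] g)
    (hP : ∀ x y : g, ⁅P x, P y⁆ = P ⁅P x, y⁆ + P ⁅x, P y⁆ + lam • P ⁅x, y⁆)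
    (ρ : g →ₗ[K] Module.End K V)
    (hρ : ∀ x y : g, ρ ⁅x, y⁆ = ρ x * ρ y - ρ y * ρ x)
    (α : V →ₗ[K] V)
    (hα : ∀ (x : g) (v : V),
        ρ (P x) (α v) = α (ρ (P x) v) + α (ρ x (α v)) + lam • α (ρ x v))
    (T : V →ₗ[K] g)
    (hT : ∀ u v : V, ⁅T u, T v⁆ = T (ρ (T u) v - ρ (T v) u))
    (hTα : ∀ v : V, P (T v) = T (α v)) :
    let c : V → V → V := fun u v => ρ (T u) v
    -- (V, ∘) is a pre-Lie algebra ...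
    (∀ u v w : V, c (c u v) w - c u (c v w) = c (c v u) w - c v (c u w)) ∧
    -- ... and α is a Rota-Baxter operator of weight λ on it
    (∀ u v : V,
      c (α u) (α v) = α (c (α u) v) + α (c u (α v)) + lam • α (c u v)) := by
  refine ⟨fun u v w => ?_, fun u v => ?_⟩
  · have h := LinearMap.congr_fun (hρ (T u) (T v)) w
    rw [hT] at h
    simp only [map_sub, LinearMap.sub_apply, Module.End.mul_apply] at h
    rw [sub_eq_sub_iff_sub_eq_sub]
    exact h
  · simpa only [hTα] using hα (T u) v
end
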